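/- arXiv:1712.10119 — 3 statements merged into one kernel-verified Lean document; each statement's English description precedes it below -/
import Mathlib

section
/- Let X be a real Banach space, p ≥ 1 an integer, and T : X ⇉ X* a p-monotone multivalued operator. Then T is pre-maximal p-monotone if and only if T^{μ_p} = T^{μ_p μ_p}. -/
open scoped BigOperators

noncomputable section

variable {X : Type*} [NormedAddCommGroup X] [NormedSpace ℝ X]

/-- The cyclic sum `∑_{i=0}^{p} ⟨x_{i+1} − x_i, x_i*⟩` (indices mod `p+1`). -/
def cyclicSum (p : ℕ) (a : Fin (p + 1) → X × (X →L[ℝ] ℝ)) : ℝ :=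
  ∑ i : Fin (p + 1), (a i).2 ((a (i + 1)).1 - (a i).1)

/-- `T` is `p`-monotone. -/
def IsPMonotone (p : ℕ) (T : Set (X × (X →L[ℝ] ℝ))) : Prop :=
  ∀ a : Fin (p + 1) → X × (X →L[ℝ] ℝ), (∀ i, a i ∈ T) → cyclicSum p a ≤ 0

/-- The `p`-monotone polar `T^{μ_p}`. -/
def pPolar (p : ℕ) (T : Set (X × (X →L[ℝ] ℝ))) : Set (X × (X →L[ℝ] ℝ)) :=
  {z | ∀ a : Fin (p + 1) → X × (X →L[ℝ] ℝ),
    a 0 = z → (∀ i, i ≠ 0 → a i ∈ T) → cyclicSum p a ≤ 0}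

/-- `T` is maximal `p`-monotone. -/
def IsMaxPMonotone (p : ℕ) (T : Set (X × (X →L[ℝ] ℝ))) : Prop :=
  IsPMonotone p T ∧
    ∀ S : Set (X × (X →L[ℝ] ℝ)), IsPMonotone p S → T ⊆ S → S = T

/-- The domain of a multivalued operator. -/
def opDom (T : Set (X × (X →L[ℝ] ℝ))) : Set X := {x | ∃ xs, (x, xs) ∈ T}

/-- `T` is pre-maximal `p`-monotone: `T` and `T^{μ_p}` are `p`-monotone. -/
def IsPreMaxPMonotone (p : ℕ) (T : Set (X × (X →L[ℝ] ℝ))) : Prop :=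
  IsPMonotone p T ∧ IsPMonotone p (pPolar p T)

/-- The normal cone operator of a set `C ⊆ X`. -/
def normalCone (C : Set X) : Set (X × (X →L[ℝ] ℝ)) :=
  {z | z.1 ∈ C ∧ ∀ y ∈ C, z.2 (y - z.1) ≤ 0}

/-- The monotone polar `T^{μ}`. -/
def monoPolar (T : Set (X × (X →L[ℝ] ℝ))) : Set (X × (X →L[ℝ] ℝ)) :=
  {z | ∀ w ∈ T, 0 ≤ (z.2 - w.2) (z.1 - w.1)}

/-- `T` is a monotone operator. -/
def IsMonotoneOp (T : Set (X × (X →L[ℝ] ℝ))) : Prop :=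
  ∀ a ∈ T, ∀ b ∈ T, 0 ≤ (a.2 - b.2) (a.1 - b.1)

/-- The operator `T_{p+} : X^{p+1} ⇉ (X*)^{p+1}`. -/
def TpPlus (p : ℕ) (T : Set (X × (X →L[ℝ] ℝ))) :
    Set ((Fin (p + 1) → X) × (Fin (p + 1) → (X →L[ℝ] ℝ))) :=
  {z | ∀ i, ∃ u v, (z.1 i, u) ∈ T ∧ (z.1 (i + 1), v) ∈ T ∧ z.2 i = u - v}

/-- The operator `T_{p−} : X^{p+1} ⇉ (X*)^{p+1}`. -/
def TpMinus (p : ℕ) (T : Set (X × (X →L[ℝ] ℝ))) :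
    Set ((Fin (p + 1) → X) × (Fin (p + 1) → (X →L[ℝ] ℝ))) :=
  {z | ∀ i, ∃ u v, (z.1 i, u) ∈ T ∧ (z.1 (i - 1), v) ∈ T ∧ z.2 i = u - v}

/-- Monotonicity for operators `X^{p+1} ⇉ (X*)^{p+1}` with the product duality pairing. -/
def IsMonotoneBig (p : ℕ)
    (S : Set ((Fin (p + 1) → X) × (Fin (p + 1) → (X →L[ℝ] ℝ)))) : Prop :=
  ∀ a ∈ S, ∀ b ∈ S, 0 ≤ ∑ i : Fin (p + 1), (a.2 i - b.2 i) (a.1 i - b.1 i)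

/-- Maximal monotonicity for operators `X^{p+1} ⇉ (X*)^{p+1}`. -/
def IsMaxMonotoneBig (p : ℕ)
    (S : Set ((Fin (p + 1) → X) × (Fin (p + 1) → (X →L[ℝ] ℝ)))) : Prop :=
  IsMonotoneBig p S ∧
    ∀ S' : Set ((Fin (p + 1) → X) × (Fin (p + 1) → (X →L[ℝ] ℝ))),
      IsMonotoneBig p S' → S ⊆ S' → S' = S

/-- The adjoint operator `T*`: `(x,x*) ∈ T*` iff `⟨x,y*⟩ = ⟨y,x*⟩` for all `(y,y*) ∈ T`. -/
def adjointOp (T : Set (X × (X →L[ℝ] ℝ))) : Set (X × (X →L[ℝ] ℝ)) :=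
  {z | ∀ w ∈ T, w.2 z.1 = z.2 w.1}

/-- The adjoint of an operator `X^{p+1} ⇉ (X*)^{p+1}` w.r.t. the product duality pairing. -/
def adjointBig (p : ℕ)
    (S : Set ((Fin (p + 1) → X) × (Fin (p + 1) → (X →L[ℝ] ℝ)))) :
    Set ((Fin (p + 1) → X) × (Fin (p + 1) → (X →L[ℝ] ℝ))) :=
  {z | ∀ w ∈ S, ∑ i : Fin (p + 1), (w.2 i) (z.1 i) = ∑ i : Fin (p + 1), (z.2 i) (w.1 i)}

theorem pPolar_anti {p : ℕ} {S T : Set (X × (X →L[ℝ] ℝ))} (h : S ⊆ T) :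
    pPolar p T ⊆ pPolar p S :=
  fun _ hz a ha0 ha => hz a ha0 fun i hi => h (ha i hi)

theorem isPMonotone_iff_subset_pPolar {p : ℕ} {T : Set (X × (X →L[ℝ] ℝ))} :
    IsPMonotone p T ↔ T ⊆ pPolar p T := by
  refine ⟨fun hT z hz a ha0 ha => hT a fun i => ?_,
    fun h a ha => h (ha 0) a rfl fun i _ => ha i⟩
  by_cases hi : i = 0
  · rwa [hi, ha0]
  · exact ha i hi

/-- A `p`-monotone `T` is pre-maximal `p`-monotone iff `T^{μ_p} = T^{μ_p μ_p}`. -/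
theorem preMax_iff_polar_eq_double_polar [CompleteSpace X] (p : ℕ) (hp : 1 ≤ p)
    (T : Set (X × (X →L[ℝ] ℝ))) (hT : IsPMonotone p T) :
    IsPreMaxPMonotone p T ↔ pPolar p T = pPolar p (pPolar p T) := by
  constructor
  · rintro ⟨-, hP⟩
    exact (isPMonotone_iff_subset_pPolar.1 hP).antisymm
      (pPolar_anti (isPMonotone_iff_subset_pPolar.1 hT))
  · intro h
    exact ⟨hT, isPMonotone_iff_subset_pPolar.2 h.subset⟩
end
end

section
/- Let X be a real Banach space, p ≥ 1 an integer, and T : X ⇉ X* a linear p-monotone multivalued operator with norm-closed domain. Then T is pre-maximal p-monotone if and only if T^{μ_p} is linear (i.e., the graph of T^{μ_p} is a linear subspace of X × X*). -/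
open scoped BigOperators

noncomputable section

variable {X : Type*} [NormedAddCommGroup X] [NormedSpace ℝ X]

section Auxiliary

theorem cyclicSum_smul (p : ℕ) (c : ℝ) (a : Fin (p + 1) → X × (X →L[ℝ] ℝ)) :
    cyclicSum p (c • a) = c ^ 2 * cyclicSum p a := by
  simp only [cyclicSum, Finset.mul_sum]
  refine Finset.sum_congr rfl fun i _ => ?_
  simp only [Pi.smul_apply, Prod.smul_fst, Prod.smul_snd, smul_apply,
    map_sub, map_smul, smul_eq_mul]
  ring

theorem cyclicSum_add_const (p : ℕ) (c : X × (X →L[ℝ] ℝ))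
    (a : Fin (p + 1) → X × (X →L[ℝ] ℝ)) :
    cyclicSum p (fun i => a i + c) = cyclicSum p a := by
  have h : ∑ i : Fin (p + 1), c.2 (a (i + 1)).1 = ∑ i : Fin (p + 1), c.2 (a i).1 :=
    Equiv.sum_comp (Equiv.addRight (1 : Fin (p + 1))) fun i => c.2 (a i).1
  simp only [cyclicSum, Prod.fst_add, Prod.snd_add, add_sub_add_right_eq_sub,
    add_apply, Finset.sum_add_distrib]
  simp [Finset.sum_sub_distrib, h]

theorem cyclicSum_congr (p : ℕ) {a b : Fin (p + 1) → X × (X →L[ℝ] ℝ)}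
    (hfst : ∀ i, (a i).1 = (b i).1)
    (hsnd : ∀ i j, (a i).2 (b j).1 = (b i).2 (b j).1) :
    cyclicSum p a = cyclicSum p b := by
  simp only [cyclicSum, hfst, map_sub, hsnd]

theorem cyclicSum_single_zero {p : ℕ} (hp : 1 ≤ p) (z : X × (X →L[ℝ] ℝ)) :
    cyclicSum p (Pi.single 0 z) = -z.2 z.1 := by
  have h01 : (0 + 1 : Fin (p + 1)) ≠ 0 := by
    obtain ⟨q, rfl⟩ := Nat.exists_eq_add_of_le' hp
    simp
  rw [cyclicSum, Finset.sum_eq_single 0]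
  · rw [Pi.single_eq_of_ne h01, Pi.single_eq_same]
    simp
  · intro i _ hi
    simp [Pi.single_eq_of_ne hi]
  · simp

theorem IsPMonotone.subset_pPolar {p : ℕ} {T : Set (X × (X →L[ℝ] ℝ))}
    (hT : IsPMonotone p T) : T ⊆ pPolar p T := by
  rintro z hz a rfl ha
  refine hT a fun i => ?_
  by_cases hi : i = 0
  · exact hi ▸ hz
  · exact ha i hi

theorem smul_mem_pPolar {p : ℕ} {L : Submodule ℝ (X × (X →L[ℝ] ℝ))} {c : ℝ} (hc : c ≠ 0)
    {z : X × (X →L[ℝ] ℝ)} (hz : z ∈ pPolar p (L : Set (X × (X →L[ℝ] ℝ)))) :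
    c • z ∈ pPolar p (L : Set (X × (X →L[ℝ] ℝ))) := by
  intro a ha0 ha
  have h := hz (c⁻¹ • a) (by simp [ha0, smul_smul, hc])
    fun i hi => L.smul_mem _ (ha i hi)
  rw [cyclicSum_smul] at h
  exact nonpos_of_mul_nonpos_right h (by positivity)

theorem add_mem_pPolar {p : ℕ} {L : Submodule ℝ (X × (X →L[ℝ] ℝ))}
    {z t : X × (X →L[ℝ] ℝ)} (hz : z ∈ pPolar p (L : Set (X × (X →L[ℝ] ℝ)))) (ht : t ∈ L) :
    z + t ∈ pPolar p (L : Set (X × (X →L[ℝ] ℝ))) := by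
  intro a ha0 ha
  rw [← cyclicSum_add_const p (-t)]
  exact hz _ (by simp [ha0]) fun i hi => L.add_mem (ha i hi) (L.neg_mem ht)

/-- The `p`-monotone polar of a `p`-monotone linear operator is linear as soon as it is
`p`-monotone. -/
theorem exists_submodule_eq_pPolar {p : ℕ} {L : Submodule ℝ (X × (X →L[ℝ] ℝ))}
    (hL : IsPMonotone p (L : Set (X × (X →L[ℝ] ℝ))))
    (hS : IsPMonotone p (pPolar p (L : Set (X × (X →L[ℝ] ℝ))))) :
    ∃ M : Submodule ℝ (X × (X →L[ℝ] ℝ)), pPolar p (L : Set (X × (X →L[ℝ] ℝ))) = ↑M := by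
  refine ⟨{ carrier := pPolar p (L : Set (X × (X →L[ℝ] ℝ)))
            zero_mem' := hL.subset_pPolar L.zero_mem
            add_mem' := ?_
            smul_mem' := ?_ }, rfl⟩
  · intro z w hz hw a ha0 ha
    rw [← cyclicSum_add_const p (-w)]
    refine hS _ fun i => ?_
    by_cases hi : i = 0
    · simpa [hi, ha0] using hz
    · have := add_mem_pPolar (smul_mem_pPolar (c := (-1 : ℝ)) (by norm_num) hw) (ha i hi)
      rwa [neg_one_smul ℝ w, add_comm] at this
  · intro c z hz
    by_cases hc : c = 0
    · rw [hc, zero_smul]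
      exact hL.subset_pPolar L.zero_mem
    · exact smul_mem_pPolar hc hz

theorem zero_prod_mem_pPolar {p : ℕ} {L : Submodule ℝ (X × (X →L[ℝ] ℝ))}
    (hL : IsPMonotone p (L : Set (X × (X →L[ℝ] ℝ)))) {f : X →L[ℝ] ℝ}
    (hf : ∀ t ∈ L, f t.1 = 0) :
    ((0, f) : X × (X →L[ℝ] ℝ)) ∈ pPolar p (L : Set (X × (X →L[ℝ] ℝ))) := by
  intro a ha0 ha
  have hmem : ∀ i, Function.update a 0 0 i ∈ L := by
    intro i
    by_cases hi : i = 0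
    · simp [hi]
    · simpa [hi] using ha i hi
  rw [cyclicSum_congr p (b := Function.update a 0 0)]
  · exact hL _ hmem
  · intro i
    by_cases hi : i = 0 <;> simp [hi, ha0]
  · intro i j
    by_cases hi : i = 0
    · rw [hi, ha0, hf _ (hmem j)]
      simp
    · simp [hi]

theorem apply_self_nonneg_of_mem_pPolar {p : ℕ} (hp : 1 ≤ p)
    {L : Submodule ℝ (X × (X →L[ℝ] ℝ))} {z : X × (X →L[ℝ] ℝ)}
    (hz : z ∈ pPolar p (L : Set (X × (X →L[ℝ] ℝ)))) : 0 ≤ z.2 z.1 := by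
  have h := hz (Pi.single 0 z) (by simp) fun i hi => by simp [Pi.single_eq_of_ne hi]
  rw [cyclicSum_single_zero hp] at h
  linarith

/-- In a linear operator with nonnegative quadratic form, values at `0` annihilate the domain. -/
theorem apply_eq_zero_of_zero_mem {M : Submodule ℝ (X × (X →L[ℝ] ℝ))}
    (hM : ∀ z ∈ M, 0 ≤ z.2 z.1) {f : X →L[ℝ] ℝ} (hf : ((0, f) : X × (X →L[ℝ] ℝ)) ∈ M)
    {z : X × (X →L[ℝ] ℝ)} (hz : z ∈ M) : f z.1 = 0 := by
  by_contra hne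
  have h := hM _ (M.add_mem hz (M.smul_mem (-(z.2 z.1 + 1) / f z.1) hf))
  simp [hne] at h
  linarith

/-- A point annihilated by every functional vanishing on a closed subspace lies in it. -/
theorem Submodule.mem_of_forall_dual_eq_zero {D : Submodule ℝ X} (hD : IsClosed (D : Set X))
    {x : X} (hx : ∀ f : X →L[ℝ] ℝ, (∀ y ∈ D, f y = 0) → f x = 0) : x ∈ D := by
  by_contra hxD
  obtain ⟨f, u, hfu, hux⟩ := geometric_hahn_banach_closed_point D.convex hD hxD
  have hu : 0 < u := by simpa using hfu 0 D.zero_mem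
  have hf : ∀ y ∈ D, f y = 0 := by
    intro y hy
    by_contra hne
    have h := hfu _ (D.smul_mem (u / f y) hy)
    simp [hne] at h
  have := hx f hf
  linarith

end Auxiliary

/-- A linear `p`-monotone operator with norm-closed domain is pre-maximal
`p`-monotone iff `T^{μ_p}` is linear. -/
theorem preMax_iff_polar_linear [CompleteSpace X] (p : ℕ) (hp : 1 ≤ p)
    (T : Set (X × (X →L[ℝ] ℝ)))
    (hlin : ∃ L : Submodule ℝ (X × (X →L[ℝ] ℝ)), T = ↑L)
    (hT : IsPMonotone p T) (hdom : IsClosed (opDom T)) :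
    IsPreMaxPMonotone p T ↔
      ∃ L : Submodule ℝ (X × (X →L[ℝ] ℝ)), pPolar p T = ↑L := by
  obtain ⟨L, rfl⟩ := hlin
  refine ⟨fun h => exists_submodule_eq_pPolar hT h.2, ?_⟩
  rintro ⟨M, hM⟩
  have hLM : ∀ t ∈ L, t ∈ M := fun t ht => hM.le (hT.subset_pPolar ht)
  have hpos : ∀ z ∈ M, 0 ≤ z.2 z.1 :=
    fun z hz => apply_self_nonneg_of_mem_pPolar hp (hM.ge hz)
  have hD : (L.map (LinearMap.fst ℝ X (X →L[ℝ] ℝ)) : Set X) =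
      opDom (L : Set (X × (X →L[ℝ] ℝ))) := by
    ext x
    simp [opDom]
  have hdomM : ∀ z ∈ M, ∃ g, (z.1, g) ∈ L := by
    intro z hz
    have hz1 : z.1 ∈ L.map (LinearMap.fst ℝ X (X →L[ℝ] ℝ)) :=
      Submodule.mem_of_forall_dual_eq_zero (hD ▸ hdom) fun f hf =>
        apply_eq_zero_of_zero_mem hpos
          (hM.le (zero_prod_mem_pPolar hT fun t ht => hf _ (Submodule.mem_map_of_mem ht))) hz
    simpa using hz1
  refine ⟨hT, fun a ha => ?_⟩
  rw [hM] at ha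
  choose g hg using fun i => hdomM (a i) (ha i)
  rw [cyclicSum_congr p (a := a) (b := fun i => ((a i).1, g i)) (fun _ => rfl)]
  · exact hT _ hg
  · intro i j
    have hdiff : ((0, (a i).2 - g i) : X × (X →L[ℝ] ℝ)) ∈ M := by
      have h := M.sub_mem (ha i) (hLM _ (hg i))
      have he : a i - ((a i).1, g i) = (0, (a i).2 - g i) := by ext <;> simp
      rwa [he] at h
    exact sub_eq_zero.mp (apply_eq_zero_of_zero_mem hpos hdiff (hLM _ (hg j)))
end
end

section
/- Let X be a real Banach space, p ≥ 1 an integer, and T : X ⇉ X* a linear multivalued operator with norm-closed domain. The following are equivalent: (1) T is maximal p-monotone; (2) T_{p+} is maximal monotone; (3) T_{p−} is maximal monotone. -/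
open scoped BigOperators

noncomputable section

variable {X : Type*} [NormedAddCommGroup X] [NormedSpace ℝ X]

/-- A real number whose multiples are all bounded by a common constant is zero. -/
lemma eq_zero_of_forall_mul_le {c d : ℝ} (h : ∀ t : ℝ, t * c ≤ d) : c = 0 := by
  by_contra hc
  have := h ((d + 1) / c)
  rw [div_mul_cancel₀ _ hc] at this
  linarith

namespace LinearMap

variable {V W : Type*} [AddCommGroup V] [Module ℝ V] [AddCommGroup W] [Module ℝ W]

/-- The fibre over `0` of a linear monotone relation annihilates its domain. -/
lemma pairing_eq_zero_of_monotone (B : V →ₗ[ℝ] W →ₗ[ℝ] ℝ) (G : Submodule ℝ (V × W))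
    (mono : ∀ g ∈ G, 0 ≤ B g.1 g.2) {g : V × W} (hg : g ∈ G) {w : W}
    (hw : ((0 : V), w) ∈ G) : B g.1 w = 0 := by
  refine eq_zero_of_forall_mul_le (d := B g.1 g.2) fun t => ?_
  have h := mono _ (G.sub_mem hg (G.smul_mem t hw))
  simp only [Prod.fst_sub, Prod.snd_sub, Prod.smul_fst, Prod.smul_snd, smul_zero, sub_zero,
    map_sub, map_smul, smul_eq_mul] at h
  linarith

/-- A linear monotone relation whose fibre over `0` is the annihilator of its domain, and whose
domain is the annihilator of that fibre, contains every point monotonically related to it. -/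
lemma mem_of_monotonically_related (B : V →ₗ[ℝ] W →ₗ[ℝ] ℝ) (G : Submodule ℝ (V × W))
    (hdom : ∀ z, (∀ w, ((0 : V), w) ∈ G → B z w = 0) → ∃ w, (z, w) ∈ G)
    (hzero : ∀ w, (∀ g ∈ G, B g.1 w = 0) → ((0 : V), w) ∈ G) {z : V × W}
    (hz : ∀ g ∈ G, 0 ≤ B (z.1 - g.1) (z.2 - g.2)) : z ∈ G := by
  obtain ⟨w, hw⟩ := hdom z.1 fun w hw => by
    refine eq_zero_of_forall_mul_le (d := B z.1 z.2) fun t => ?_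
    have h := hz _ (G.smul_mem t hw)
    simp only [Prod.smul_fst, Prod.smul_snd, smul_zero, sub_zero, map_sub, map_smul,
      smul_eq_mul] at h
    linarith
  have hd : ((0 : V), z.2 - w) ∈ G := hzero _ fun g hg => by
    have key : ∀ t : ℝ, t * B g.1 (z.2 - w) ≤ t * t * B g.1 g.2 := fun t => by
      have h := hz _ (G.add_mem hw (G.smul_mem t hg))
      have h1 : z.1 - ((z.1, w) + t • g).1 = -(t • g.1) := by simp
      have h2 : z.2 - ((z.1, w) + t • g).2 = (z.2 - w) - t • g.2 := by
        simp [sub_sub]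
      rw [h1, h2] at h
      simp only [map_neg, map_smul, LinearMap.neg_apply, LinearMap.smul_apply, smul_eq_mul,
        map_sub _ (z.2 - w)] at h
      linarith
    by_contra hne
    generalize B g.1 (z.2 - w) = c at key hne
    generalize B g.1 g.2 = d at key
    have hk := key (c / (|d| + 1))
    have hpos : 0 < |d| + 1 := by positivity
    have hc : 0 < c * c := mul_self_pos.mpr hne
    have e1 : c / (|d| + 1) * c = c * c / (|d| + 1) := by ring
    have e2 : c / (|d| + 1) * (c / (|d| + 1)) * d = c * c / (|d| + 1) * (d / (|d| + 1)) := by ring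
    rw [e1, e2] at hk
    have hlt : d / (|d| + 1) < 1 := by
      rw [div_lt_one hpos]; linarith [le_abs_self d]
    have := mul_lt_mul_of_pos_left hlt (div_pos hc hpos)
    linarith
  have := G.add_mem hw hd
  simpa using this

end LinearMap

/-- The evaluation pairing between `X` and its dual. -/
def evalPairing (X : Type*) [NormedAddCommGroup X] [NormedSpace ℝ X] :
    X →ₗ[ℝ] (X →L[ℝ] ℝ) →ₗ[ℝ] ℝ :=
  LinearMap.mk₂ ℝ (fun x f => f x) (by simp) (by simp) (by simp) (by simp)

/-- The product duality pairing between `X^ι` and `(X*)^ι`. -/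
def piPairing (ι X : Type*) [Fintype ι] [NormedAddCommGroup X] [NormedSpace ℝ X] :
    (ι → X) →ₗ[ℝ] (ι → (X →L[ℝ] ℝ)) →ₗ[ℝ] ℝ :=
  LinearMap.mk₂ ℝ (fun x f => ∑ i, f i (x i))
    (by simp [Finset.sum_add_distrib]) (by simp [Finset.mul_sum])
    (by simp [Finset.sum_add_distrib]) (by simp [Finset.mul_sum])

@[simp]
lemma evalPairing_apply (x : X) (f : X →L[ℝ] ℝ) : evalPairing X x f = f x := rfl

@[simp]
lemma piPairing_apply {ι : Type*} [Fintype ι] (x : ι → X) (f : ι → (X →L[ℝ] ℝ)) :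
    piPairing ι X x f = ∑ i, f i (x i) := rfl

/-- The linear relation `x ↦ (T x_i - T x_{σ i})_i` on `X^ι`. -/
def diffRelation {ι : Type*} (L : Submodule ℝ (X × (X →L[ℝ] ℝ))) (σ : Equiv.Perm ι) :
    Submodule ℝ ((ι → X) × (ι → (X →L[ℝ] ℝ))) where
  carrier := {z | ∀ i, ∃ u v, (z.1 i, u) ∈ L ∧ (z.1 (σ i), v) ∈ L ∧ z.2 i = u - v}
  zero_mem' := fun _ => ⟨0, 0, L.zero_mem, L.zero_mem, by simp⟩
  add_mem' := fun {a b} ha hb i => by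
    obtain ⟨u, v, hu, hv, h⟩ := ha i
    obtain ⟨u', v', hu', hv', h'⟩ := hb i
    exact ⟨u + u', v + v', L.add_mem hu hu', L.add_mem hv hv', by
      simp only [Prod.snd_add, Pi.add_apply, h, h']; abel⟩
  smul_mem' := fun t a ha i => by
    obtain ⟨u, v, hu, hv, h⟩ := ha i
    exact ⟨t • u, t • v, L.smul_mem t hu, L.smul_mem t hv, by
      simp only [Prod.smul_snd, Pi.smul_apply, h, smul_sub]⟩

section DiffRelation

variable {ι : Type*} {L : Submodule ℝ (X × (X →L[ℝ] ℝ))} {σ : Equiv.Perm ι}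

lemma zero_mem_diffRelation_iff {w : ι → (X →L[ℝ] ℝ)} :
    ((0 : ι → X), w) ∈ diffRelation L σ ↔ ∀ i, ((0 : X), w i) ∈ L := by
  refine ⟨fun h i => ?_, fun h i => ⟨w i, 0, h i, L.zero_mem, by simp⟩⟩
  obtain ⟨u, v, hu, hv, e⟩ := h i
  have := L.sub_mem hu hv
  simp only [Pi.zero_apply, Prod.mk_sub_mk, sub_zero] at this e
  rwa [e]

lemma exists_mem_diffRelation_iff {x : ι → X} :
    (∃ w, (x, w) ∈ diffRelation L σ) ↔ ∀ i, ∃ u, (x i, u) ∈ L := by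
  refine ⟨fun ⟨w, h⟩ i => ?_, fun h => ?_⟩
  · obtain ⟨u, _, hu, _⟩ := h i
    exact ⟨u, hu⟩
  · choose u hu using h
    exact ⟨fun i => u i - u (σ i), fun i => ⟨u i, u (σ i), hu i, hu _, rfl⟩⟩

variable [Fintype ι]

lemma sum_sub_perm_symm (σ : Equiv.Perm ι) (c : ι → (X →L[ℝ] ℝ)) (x : ι → X) :
    ∑ i, (c i - c (σ i)) (x i) = ∑ i, c i (x i - x (σ.symm i)) := by
  simp only [sub_apply, map_sub, Finset.sum_sub_distrib]
  congr 1
  exact Equiv.sum_comp σ (fun i => c i (x (σ.symm i))) ▸ by simp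

lemma sum_nonneg_of_diffRelation_monotone
    (hS : ∀ z ∈ diffRelation L σ, 0 ≤ ∑ i, z.2 i (z.1 i))
    (a : ι → X × (X →L[ℝ] ℝ)) (ha : ∀ i, a i ∈ L) :
    0 ≤ ∑ i, (a i).2 ((a i).1 - (a (σ.symm i)).1) := by
  rw [← sum_sub_perm_symm σ (fun i => (a i).2) (fun i => (a i).1)]
  exact hS (fun i => (a i).1, fun i => (a i).2 - (a (σ i)).2)
    fun i => ⟨_, _, ha i, ha (σ i), rfl⟩

lemma diffRelation_monotone_of_sum_nonneg
    (hL : ∀ n, ((0 : X), n) ∈ L → ∀ g ∈ L, n g.1 = 0)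
    (h : ∀ a : ι → X × (X →L[ℝ] ℝ), (∀ i, a i ∈ L) →
      0 ≤ ∑ i, (a i).2 ((a i).1 - (a (σ.symm i)).1)) :
    ∀ z ∈ diffRelation L σ, 0 ≤ ∑ i, z.2 i (z.1 i) := by
  intro z hz
  choose u v hu hv e using hz
  convert h (fun i => (z.1 i, u i)) hu using 1
  rw [← sum_sub_perm_symm σ u z.1]
  refine Finset.sum_congr rfl fun i _ => ?_
  have hd := L.sub_mem (hu (σ i)) (hv i)
  rw [Prod.mk_sub_mk, sub_self] at hd
  have := hL _ hd _ (hu i)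
  rw [e]
  simp only [sub_apply] at this ⊢
  linarith

end DiffRelation

/-- If the fibre of a linear relation over `0` contains the annihilator of its closed domain, then
every point killed by that fibre lies in the domain. -/
lemma mem_opDom_of_forall_annihilator (L : Submodule ℝ (X × (X →L[ℝ] ℝ)))
    (hdom : IsClosed (opDom (L : Set (X × (X →L[ℝ] ℝ)))))
    (hzero : ∀ w : X →L[ℝ] ℝ, (∀ g ∈ L, w g.1 = 0) → ((0 : X), w) ∈ L) {z : X}
    (hz : ∀ w : X →L[ℝ] ℝ, ((0 : X), w) ∈ L → w z = 0) : ∃ w, (z, w) ∈ L := by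
  by_contra hne
  have hD : (opDom (L : Set (X × (X →L[ℝ] ℝ)))) = L.map (LinearMap.fst ℝ X (X →L[ℝ] ℝ)) := by
    ext x; simp [opDom]
  have hconv : Convex ℝ (opDom (L : Set (X × (X →L[ℝ] ℝ)))) := hD ▸ Submodule.convex _
  obtain ⟨f, u, hf, hu⟩ := geometric_hahn_banach_closed_point hconv hdom hne
  have hf0 : ∀ g ∈ L, f g.1 = 0 := fun g hg =>
    eq_zero_of_forall_mul_le (d := u) fun t => by
      have := hf (t • g.1) ⟨t • g.2, L.smul_mem t hg⟩
      simpa using this.le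
  have h0 := hf 0 ⟨0, L.zero_mem⟩
  rw [map_zero] at h0
  have := hz f (hzero f hf0)
  linarith

section PMonotone

variable {p : ℕ}

lemma IsPMonotone.isMonotoneOp (hp : 1 ≤ p) {T : Set (X × (X →L[ℝ] ℝ))}
    (hT : IsPMonotone p T) : IsMonotoneOp T := by
  intro a ha b hb
  obtain ⟨q, rfl⟩ : ∃ q, p = q + 1 := ⟨p - 1, by omega⟩
  have h := hT (Fin.cons a fun _ => b) fun i => by
    refine Fin.cases ?_ (fun _ => ?_) i <;> simpa
  have hlast : (Fin.last q).succ + 1 = (0 : Fin (q + 1 + 1)) := by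
    rw [Fin.succ_last]; exact Fin.last_add_one _
  have hmid : ∀ j : Fin q, (j.castSucc.succ : Fin (q + 1 + 1)) + 1 = j.succ.succ := by
    intro j; rw [← Fin.castSucc_succ]; exact Fin.coeSucc_eq_succ
  have hone : (0 : Fin (q + 1 + 1)) + 1 = Fin.succ 0 := by simp
  unfold cyclicSum at h
  rw [Fin.sum_univ_succ, Fin.sum_univ_castSucc, hlast, hone] at h
  simp only [hmid, Fin.cons_zero, Fin.cons_succ, sub_self, map_zero, Finset.sum_const_zero,
    zero_add] at h
  simp only [sub_apply, map_sub] at h ⊢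
  linarith

lemma isPMonotone_iff_forall_sum_sub_add_one {T : Set (X × (X →L[ℝ] ℝ))} :
    IsPMonotone p T ↔ ∀ a : Fin (p + 1) → X × (X →L[ℝ] ℝ), (∀ i, a i ∈ T) →
      0 ≤ ∑ i, (a i).2 ((a i).1 - (a (i + 1)).1) := by
  refine forall₂_congr fun a _ => ?_
  rw [← neg_nonneg, cyclicSum, ← Finset.sum_neg_distrib]
  simp only [← map_neg, neg_sub]

lemma isPMonotone_iff_forall_sum_sub_sub_one {T : Set (X × (X →L[ℝ] ℝ))} :
    IsPMonotone p T ↔ ∀ a : Fin (p + 1) → X × (X →L[ℝ] ℝ), (∀ i, a i ∈ T) →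
      0 ≤ ∑ i, (a i).2 ((a i).1 - (a (i - 1)).1) := by
  have hrefl (a : Fin (p + 1) → X × (X →L[ℝ] ℝ)) :
      ∑ i, (a i).2 ((a i).1 - (a (i - 1)).1) =
        ∑ i, (a (-i)).2 ((a (-i)).1 - (a (-(i + 1))).1) := by
    rw [← Equiv.sum_comp (Equiv.neg (Fin (p + 1)))]
    refine Finset.sum_congr rfl fun i _ => ?_
    rw [Equiv.neg_apply, neg_add']
  rw [isPMonotone_iff_forall_sum_sub_add_one]
  refine ⟨fun h a ha => ?_, fun h a ha => ?_⟩
  · rw [hrefl]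
    exact h (fun i => a (-i)) fun i => ha _
  · have := h (fun i => a (-i)) fun i => ha _
    rw [hrefl] at this
    simpa only [neg_neg] using this

/-- The fibre over `0` of a maximal `p`-monotone linear relation contains the annihilator of the
domain. -/
lemma IsMaxPMonotone.zero_mem {L : Submodule ℝ (X × (X →L[ℝ] ℝ))}
    (hT : IsMaxPMonotone p (L : Set (X × (X →L[ℝ] ℝ)))) {w : X →L[ℝ] ℝ}
    (hw : ∀ g ∈ L, w g.1 = 0) : ((0 : X), w) ∈ L := by
  set S : Set (X × (X →L[ℝ] ℝ)) :=
    {z | ∃ u, (z.1, u) ∈ L ∧ ∀ g ∈ L, (z.2 - u) g.1 = 0}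
  have hS : IsPMonotone p S := fun a ha => by
    choose u hu hua using ha
    convert hT.1 (fun i => ((a i).1, u i)) hu using 1
    refine Finset.sum_congr rfl fun i _ => ?_
    have := hua i _ (L.sub_mem (hu (i + 1)) (hu i))
    rwa [sub_apply, sub_eq_zero] at this
  have hTS : (L : Set (X × (X →L[ℝ] ℝ))) ⊆ S := fun z hz => ⟨z.2, hz, by simp⟩
  have hmem : ((0 : X), w) ∈ S := ⟨0, L.zero_mem, by simpa using hw⟩
  rwa [hT.2 S hS hTS] at hmem

/-- The fibre over `0` of a maximal monotone linear relation on `X^{p+1}` contains the annihilator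
of the domain. -/
lemma IsMaxMonotoneBig.zero_mem
    {G : Submodule ℝ ((Fin (p + 1) → X) × (Fin (p + 1) → (X →L[ℝ] ℝ)))}
    (hG : IsMaxMonotoneBig p (G : Set ((Fin (p + 1) → X) × (Fin (p + 1) → (X →L[ℝ] ℝ)))))
    {w : Fin (p + 1) → (X →L[ℝ] ℝ)} (hw : ∀ g ∈ G, ∑ i, w i (g.1 i) = 0) :
    ((0 : Fin (p + 1) → X), w) ∈ G := by
  have hpos : ∀ g ∈ G, 0 ≤ ∑ i, g.2 i (g.1 i) := fun g hg => by
    simpa using hG.1 g hg 0 G.zero_mem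
  have hins : IsMonotoneBig p
      (insert ((0 : Fin (p + 1) → X), w) (G : Set ((Fin (p + 1) → X) × _))) := by
    rintro a (rfl | ha) b (rfl | hb)
    · simp
    · have := hpos b hb
      have h0 := hw b hb
      simpa [Finset.sum_add_distrib, h0] using this
    · have := hpos a ha
      have h0 := hw a ha
      simpa [h0] using this
    · exact hG.1 a ha b hb
  have hmem := Set.mem_insert ((0 : Fin (p + 1) → X), w) (G : Set ((Fin (p + 1) → X) × _))
  rwa [hG.2 _ hins (Set.subset_insert _ _)] at hmem

/-- Maximality criterion shared by `T_{p+}` and `T_{p−}`. -/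
lemma isMaxPMonotone_iff_isMaxMonotoneBig_diffRelation (hp : 1 ≤ p)
    (L : Submodule ℝ (X × (X →L[ℝ] ℝ)))
    (hdom : IsClosed (opDom (L : Set (X × (X →L[ℝ] ℝ))))) (σ : Equiv.Perm (Fin (p + 1)))
    (hσ : IsPMonotone p (L : Set (X × (X →L[ℝ] ℝ))) ↔
      ∀ a : Fin (p + 1) → X × (X →L[ℝ] ℝ), (∀ i, a i ∈ L) →
        0 ≤ ∑ i, (a i).2 ((a i).1 - (a (σ.symm i)).1)) :
    IsMaxPMonotone p (L : Set (X × (X →L[ℝ] ℝ))) ↔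
      IsMaxMonotoneBig p (diffRelation L σ :
        Set ((Fin (p + 1) → X) × (Fin (p + 1) → (X →L[ℝ] ℝ)))) := by
  constructor
  · intro hT
    have hzero : ∀ w : X →L[ℝ] ℝ, (∀ g ∈ L, w g.1 = 0) → ((0 : X), w) ∈ L :=
      fun _ => hT.zero_mem
    have hmono := hT.1.isMonotoneOp hp
    have hann : ∀ n, ((0 : X), n) ∈ L → ∀ g ∈ L, n g.1 = 0 := fun n hn g hg =>
      LinearMap.pairing_eq_zero_of_monotone (evalPairing X) L
        (fun g hg => by simpa using hmono g hg 0 L.zero_mem) hg hn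
    have hpos := diffRelation_monotone_of_sum_nonneg hann (hσ.1 hT.1)
    refine ⟨fun a ha b hb => hpos _ ((diffRelation L σ).sub_mem ha hb), fun S hS hLS => ?_⟩
    refine Set.Subset.antisymm (fun z hz => ?_) hLS
    refine LinearMap.mem_of_monotonically_related (piPairing (Fin (p + 1)) X) (diffRelation L σ)
      (fun x hx => exists_mem_diffRelation_iff.2 fun i => ?_)
      (fun w hw => zero_mem_diffRelation_iff.2 fun i => ?_)
      (fun g hg => hS z hz g (hLS hg))
    · refine mem_opDom_of_forall_annihilator L hdom hzero fun n hn => ?_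
      have := hx (Pi.single i n) (zero_mem_diffRelation_iff.2 fun j => by
        rcases eq_or_ne j i with rfl | hj
        · simpa using hn
        · rw [Pi.single_eq_of_ne hj]; exact L.zero_mem)
      rw [piPairing_apply, Finset.sum_eq_single i (fun j _ hj => by simp [hj]) (by simp)] at this
      simpa using this
    · refine hzero _ fun g hg => ?_
      obtain ⟨v, hv⟩ := exists_mem_diffRelation_iff (L := L) (σ := σ)
        (x := Pi.single i g.1) |>.2 fun j => by
          rcases eq_or_ne j i with rfl | hj
          · exact ⟨g.2, by simpa using hg⟩
          · exact ⟨0, by rw [Pi.single_eq_of_ne hj]; exact L.zero_mem⟩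
      have := hw _ hv
      rw [piPairing_apply, Finset.sum_eq_single i (fun j _ hj => by simp [hj]) (by simp)] at this
      simpa using this
  · intro hG
    have hzero : ∀ w : X →L[ℝ] ℝ, (∀ g ∈ L, w g.1 = 0) → ((0 : X), w) ∈ L := fun w hw =>
      zero_mem_diffRelation_iff.1 (hG.zero_mem (w := fun _ => w) fun g hg =>
        Finset.sum_eq_zero fun i _ => by
          obtain ⟨u, _, hu, _⟩ := hg i
          exact hw _ hu) 0
    refine ⟨hσ.2 (sum_nonneg_of_diffRelation_monotone fun g hg => by
      simpa using hG.1 g hg 0 (diffRelation L σ).zero_mem), fun S hS hLS => ?_⟩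
    have hmono := hS.isMonotoneOp hp
    refine Set.Subset.antisymm (fun z hz => ?_) hLS
    exact LinearMap.mem_of_monotonically_related (evalPairing X) L
      (fun x hx => mem_opDom_of_forall_annihilator L hdom hzero hx) hzero
      (fun g hg => hmono z hz g (hLS hg))

end PMonotone

/-- For a linear operator `T` with norm-closed domain, TFAE: (1) `T` is maximal
`p`-monotone; (2) `T_{p+}` is maximal monotone; (3) `T_{p−}` is maximal monotone. -/
theorem maxPMonotone_tfae_Tp [CompleteSpace X] (p : ℕ) (hp : 1 ≤ p)
    (T : Set (X × (X →L[ℝ] ℝ)))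
    (hlin : ∃ L : Submodule ℝ (X × (X →L[ℝ] ℝ)), T = ↑L)
    (hdom : IsClosed (opDom T)) :
    [IsMaxPMonotone p T,
     IsMaxMonotoneBig p (TpPlus p T),
     IsMaxMonotoneBig p (TpMinus p T)].TFAE := by
  obtain ⟨L, rfl⟩ := hlin
  tfae_have 1 ↔ 2 := isMaxPMonotone_iff_isMaxMonotoneBig_diffRelation hp L hdom
    (Equiv.addRight 1) (by
      simpa [sub_eq_add_neg] using
        isPMonotone_iff_forall_sum_sub_sub_one (p := p) (T := (L : Set (X × (X →L[ℝ] ℝ)))))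
  tfae_have 1 ↔ 3 := isMaxPMonotone_iff_isMaxMonotoneBig_diffRelation hp L hdom
    (Equiv.subRight 1) isPMonotone_iff_forall_sum_sub_add_one
  tfae_finish
end
end
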